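/- Let Φ={φ_i}_{i∈Λ} be an analytic IFS on I=[0,1] with 0<|φ_i'(x)|<1 for all i∈Λ and x∈I, whose maps have no common fixed point, let p be a positive probability vector and μ the associated self-conformal measure. For every 0<ε<1 there exists δ>0 such that for every C¹ map ψ:I→ℝ with ε ≤ |ψ'(x)| ≤ ε^{-1} for all x∈I and every n≥0, ψμ( ∪_{D∈D_n} (∂D)^{(2^{-n}δ)} ) < ε, where (∂D)^{(t)} denotes the closed t-neighbourhood of the boundary of D. -/

import Mathlib

open MeasureTheory Filter Set Metric Topology

noncomputable section

/-- The unit interval `I = [0,1]`. -/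
def unitI : Set ℝ := Set.Icc 0 1

/-- For a word `u = i₁…iₙ`, `compWord φ u = φ_{i₁} ∘ … ∘ φ_{iₙ}`. -/
def compWord {Λ : Type*} (φ : Λ → ℝ → ℝ) : List Λ → ℝ → ℝ
  | [] => id
  | i :: u => φ i ∘ compWord φ u

/-- `μ` is exact dimensional with dimension `d`. -/
def ExactDimWith (μ : Measure ℝ) (d : ℝ) : Prop :=
  ∀ᵐ x ∂μ, Tendsto (fun δ : ℝ =>
      Real.log (μ (Metric.closedBall x δ)).toReal / Real.log δ)
    (nhdsWithin 0 (Set.Ioi 0)) (nhds d)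

/-- The level-`n` dyadic interval `[m/2^n, (m+1)/2^n)`. -/
def dyadIco (n : ℕ) (m : ℤ) : Set ℝ :=
  Set.Ico ((m : ℝ) / 2 ^ n) (((m : ℝ) + 1) / 2 ^ n)

/-- Entropy of a measure on `ℝ` with respect to the level-`n` dyadic partition
(logarithms in base 2). -/
def ent1 (n : ℕ) (θ : Measure ℝ) : ℝ :=
  -∑' m : ℤ, (θ (dyadIco n m)).toReal * Real.logb 2 (θ (dyadIco n m)).toReal

/-- The level-`n` dyadic cell containing `x`. -/
def dcell (n : ℕ) (x : ℝ) : Set ℝ := dyadIco n ⌊x * 2 ^ n⌋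

/-- The level-`n` component `θ_{x,n}`: `θ` conditioned on the dyadic cell of `x`. -/
def dcomp (θ : Measure ℝ) (x : ℝ) (n : ℕ) : Measure ℝ :=
  (θ (dcell n x))⁻¹ • θ.restrict (dcell n x)

/-- The distortion of `f` on `s` is at most `K`: any two slopes of `f` over `s` are comparable. -/
def DistortionOn (f : ℝ → ℝ) (s : Set ℝ) (K : ℝ) : Prop :=
  ∀ x ∈ s, ∀ y ∈ s, ∀ z ∈ s, ∀ w ∈ s, |f x - f y| * |z - w| ≤ K * (|f z - f w| * |x - y|)

theorem DistortionOn.mono {f : ℝ → ℝ} {s : Set ℝ} {K K' : ℝ} (hf : DistortionOn f s K)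
    (hK : K ≤ K') : DistortionOn f s K' := fun x hx y hy z hz w hw =>
  (hf x hx y hy z hz w hw).trans (by gcongr)

theorem DistortionOn.comp {f g : ℝ → ℝ} {s t : Set ℝ} {K K' : ℝ} (hg : DistortionOn g t K')
    (hf : DistortionOn f s K) (hst : MapsTo f s t) (hK : 0 ≤ K) (hK' : 0 ≤ K') :
    DistortionOn (g ∘ f) s (K' * K) := by
  intro x hx y hy z hz w hw
  have h1 := hf x hx y hy z hz w hw
  have h2 := hg _ (hst hx) _ (hst hy) _ (hst hz) _ (hst hw)
  simp only [Function.comp]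
  have hR : 0 ≤ K' * K * (|g (f z) - g (f w)| * |x - y|) := by positivity
  rcases (abs_nonneg (f z - f w)).eq_or_lt with h0 | h0
  · rw [← h0, zero_mul, mul_zero] at h1
    have h3 : |f x - f y| * |z - w| = 0 := le_antisymm h1 (by positivity)
    rcases mul_eq_zero.1 h3 with h | h
    · rw [sub_eq_zero.1 (abs_eq_zero.1 h)]
      simpa using hR
    · rw [h, mul_zero]
      exact hR
  · refine le_of_mul_le_mul_right ?_ h0
    calc |g (f x) - g (f y)| * |z - w| * |f z - f w|
        = |g (f x) - g (f y)| * |f z - f w| * |z - w| := by ring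
      _ ≤ K' * (|g (f z) - g (f w)| * |f x - f y|) * |z - w| := by gcongr
      _ = K' * |g (f z) - g (f w)| * (|f x - f y| * |z - w|) := by ring
      _ ≤ K' * |g (f z) - g (f w)| * (K * (|f z - f w| * |x - y|)) := by gcongr
      _ = _ := by ring

theorem distortionOn_of_bilipschitz {f : ℝ → ℝ} {s : Set ℝ} {a b : ℝ} (ha : 0 < a) (hb : 0 ≤ b)
    (hlow : ∀ x ∈ s, ∀ y ∈ s, a * |x - y| ≤ |f x - f y|)
    (hup : ∀ x ∈ s, ∀ y ∈ s, |f x - f y| ≤ b * |x - y|) : DistortionOn f s (b / a) := by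
  intro x hx y hy z hz w hw
  rw [div_mul_eq_mul_div, le_div_iff₀ ha]
  calc |f x - f y| * |z - w| * a = |f x - f y| * (a * |z - w|) := by ring
    _ ≤ b * |x - y| * |f z - f w| := by
      gcongr
      exacts [hup x hx y hy, hlow z hz w hw]
    _ = _ := by ring

/-- The mean value theorem on `unitI`, without ordering the endpoints. -/
theorem exists_slope_eq_deriv {f : ℝ → ℝ} (hf : ContinuousOn f unitI)
    (hd : ∀ x ∈ interior unitI, DifferentiableAt ℝ f x) {x y : ℝ} (hx : x ∈ unitI)
    (hy : y ∈ unitI) (hxy : x ≠ y) :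
    ∃ c ∈ interior unitI, c ∈ uIcc x y ∧ |f x - f y| = |deriv f c| * |x - y| := by
  wlog h : x < y generalizing x y
  · obtain ⟨c, hc, hc', he⟩ := this hy hx hxy.symm (lt_of_le_of_ne (not_lt.1 h) hxy.symm)
    exact ⟨c, hc, by rwa [uIcc_comm], by rw [abs_sub_comm, he, abs_sub_comm y x]⟩
  have hsub : Icc x y ⊆ unitI := Icc_subset_Icc hx.1 hy.2
  have hint : Ioo x y ⊆ interior unitI := by
    rw [unitI, interior_Icc]
    exact Ioo_subset_Ioo hx.1 hy.2
  obtain ⟨c, hc, he⟩ := exists_deriv_eq_slope f h (hf.mono hsub)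
    (fun z hz => (hd z (hint hz)).differentiableWithinAt)
  refine ⟨c, hint hc, ?_, ?_⟩
  · rw [uIcc_of_le h.le]
    exact Ioo_subset_Icc_self hc
  · rw [he, abs_sub_comm (f x), abs_sub_comm x, abs_div,
      div_mul_cancel₀ _ (abs_pos.2 (sub_pos.2 h).ne').ne']

theorem bilipschitz_of_deriv_bounds {f : ℝ → ℝ} (hf : ContinuousOn f unitI)
    (hd : ∀ x ∈ interior unitI, DifferentiableAt ℝ f x) {a b : ℝ}
    (hab : ∀ x ∈ interior unitI, a ≤ |deriv f x| ∧ |deriv f x| ≤ b) :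
    ∀ x ∈ unitI, ∀ y ∈ unitI, a * |x - y| ≤ |f x - f y| ∧ |f x - f y| ≤ b * |x - y| := by
  intro x hx y hy
  rcases eq_or_ne x y with rfl | hxy
  · simp
  obtain ⟨c, hc, -, he⟩ := exists_slope_eq_deriv hf hd hx hy hxy
  rw [he]
  exact ⟨by gcongr; exact (hab c hc).1, by gcongr; exact (hab c hc).2⟩

theorem abs_sub_le_of_mem_uIcc {x y z w a b d : ℝ} (ha : a ∈ uIcc x y) (hb : b ∈ uIcc z w)
    (h1 : |x - z| ≤ d) (h2 : |x - w| ≤ d) (h3 : |y - z| ≤ d) (h4 : |y - w| ≤ d) :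
    |a - b| ≤ d := by
  rw [abs_le] at *
  rw [mem_uIcc] at ha hb
  rcases ha with ha | ha <;> rcases hb with hb | hb <;> constructor <;> linarith

/-- A non-singular analytic map has distortion tending to `1` at small scales. -/
theorem exists_contraction_distortion_bounds {f : ℝ → ℝ} (hf : AnalyticOnNhd ℝ f unitI)
    (hderiv : ∀ x ∈ unitI, 0 < |deriv f x| ∧ |deriv f x| < 1) :
    ∃ ρ m L : ℝ, 0 < ρ ∧ ρ < 1 ∧ 0 < m ∧ 0 ≤ L ∧
      (∀ x ∈ unitI, ∀ y ∈ unitI, m * |x - y| ≤ |f x - f y| ∧ |f x - f y| ≤ ρ * |x - y|) ∧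
      ∀ s ⊆ unitI, ∀ d : ℝ, (∀ x ∈ s, ∀ y ∈ s, |x - y| ≤ d) → DistortionOn f s (1 + L * d) := by
  have hI : IsCompact unitI := isCompact_Icc
  have hne : unitI.Nonempty := ⟨0, by simp [unitI]⟩
  have hc : ContinuousOn f unitI := hf.continuousOn
  have hd : ∀ x ∈ interior unitI, DifferentiableAt ℝ f x :=
    fun x hx => (hf x (interior_subset hx)).differentiableAt
  have hc' : ContinuousOn (fun x => |deriv f x|) unitI := hf.deriv.continuousOn.abs
  obtain ⟨xM, hxM, hM⟩ := hI.exists_isMaxOn hne hc'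
  obtain ⟨xm, hxm, hm⟩ := hI.exists_isMinOn hne hc'
  obtain ⟨C, hC⟩ := hI.exists_bound_of_continuousOn hf.deriv.deriv.continuousOn
  have hC0 : 0 ≤ C := (norm_nonneg _).trans (hC _ hxM)
  have hm0 := (hderiv xm hxm).1
  have hlip : ∀ a ∈ unitI, ∀ b ∈ unitI, |deriv f a - deriv f b| ≤ C * |a - b| := by
    intro a ha b hb
    exact (convex_Icc (0 : ℝ) 1).norm_image_sub_le_of_norm_deriv_le
      (fun x hx => (hf.deriv x hx).differentiableAt) (fun x hx => hC x hx) hb ha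
  refine ⟨|deriv f xM|, |deriv f xm|, C / |deriv f xm|, (hderiv xM hxM).1, (hderiv xM hxM).2,
    hm0, by positivity, ?_, ?_⟩
  · exact bilipschitz_of_deriv_bounds hc hd
      fun x hx => ⟨hm (interior_subset hx), hM (interior_subset hx)⟩
  · intro s hs d hsd x hx y hy z hz w hw
    rcases eq_or_ne x y with rfl | hxy
    · simp
    rcases eq_or_ne z w with rfl | hzw
    · simp
    obtain ⟨a, haI, ha, hae⟩ := exists_slope_eq_deriv hc hd (hs hx) (hs hy) hxy
    obtain ⟨b, hbI, hb, hbe⟩ := exists_slope_eq_deriv hc hd (hs hz) (hs hw) hzw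
    have haI := interior_subset haI
    have hbI := interior_subset hbI
    have hab : |a - b| ≤ d := abs_sub_le_of_mem_uIcc ha hb (hsd x hx z hz) (hsd x hx w hw)
      (hsd y hy z hz) (hsd y hy w hw)
    have hd0 : 0 ≤ d := (abs_nonneg _).trans hab
    have key : |deriv f a| ≤ (1 + C / |deriv f xm| * d) * |deriv f b| := by
      have h1 : |deriv f a| ≤ |deriv f b| + C * d := by
        have h2 := hlip a haI b hbI
        have h3 := abs_sub_abs_le_abs_sub (deriv f a) (deriv f b)
        have h4 : C * |a - b| ≤ C * d := by gcongr
        linarith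
      have h5 : C * d ≤ C / |deriv f xm| * d * |deriv f b| := by
        have h6 : |deriv f xm| ≤ |deriv f b| := hm hbI
        calc C * d = C / |deriv f xm| * d * |deriv f xm| := by field_simp
          _ ≤ _ := by gcongr
      linarith
    rw [hae, hbe]
    calc |deriv f a| * |x - y| * |z - w|
        ≤ (1 + C / |deriv f xm| * d) * |deriv f b| * |x - y| * |z - w| := by gcongr
      _ = _ := by ring

theorem compWord_append_singleton {Λ : Type*} (φ : Λ → ℝ → ℝ) (u : List Λ) (i : Λ) :
    compWord φ (u ++ [i]) = compWord φ u ∘ φ i := by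
  induction u with
  | nil => rfl
  | cons j u ih => simp only [List.cons_append, compWord, ih, Function.comp_assoc]

theorem mapsTo_compWord {Λ : Type*} {φ : Λ → ℝ → ℝ} {s : Set ℝ} (h : ∀ i, MapsTo (φ i) s s)
    (u : List Λ) : MapsTo (compWord φ u) s s := by
  induction u with
  | nil => exact mapsTo_id s
  | cons j u ih => exact (h j).comp ih

theorem continuousOn_compWord {Λ : Type*} {φ : Λ → ℝ → ℝ} {s : Set ℝ}
    (h : ∀ i, MapsTo (φ i) s s) (hc : ∀ i, ContinuousOn (φ i) s) (u : List Λ) :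
    ContinuousOn (compWord φ u) s := by
  induction u with
  | nil => exact continuousOn_id
  | cons j u ih => exact (hc j).comp ih (mapsTo_compWord h u)

theorem abs_compWord_sub_le {Λ : Type*} {φ : Λ → ℝ → ℝ} {s : Set ℝ}
    (h : ∀ i, MapsTo (φ i) s s) {ρ : ℝ} (hρ : 0 ≤ ρ)
    (hlip : ∀ i, ∀ x ∈ s, ∀ y ∈ s, |φ i x - φ i y| ≤ ρ * |x - y|) (u : List Λ) :
    ∀ x ∈ s, ∀ y ∈ s, |compWord φ u x - compWord φ u y| ≤ ρ ^ u.length * |x - y| := by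
  induction u with
  | nil => simp [compWord]
  | cons j u ih =>
    intro x hx y hy
    calc |compWord φ (j :: u) x - compWord φ (j :: u) y|
        ≤ ρ * |compWord φ u x - compWord φ u y| :=
          hlip j _ (mapsTo_compWord h u hx) _ (mapsTo_compWord h u hy)
      _ ≤ ρ * (ρ ^ u.length * |x - y|) := by gcongr; exact ih x hx y hy
      _ = _ := by simp only [List.length_cons]; ring

theorem distortionOn_compWord {Λ : Type*} {φ : Λ → ℝ → ℝ}
    (h : ∀ i, MapsTo (φ i) unitI unitI) {ρ L : ℝ} (hρ : 0 ≤ ρ) (hρ1 : ρ < 1) (hL : 0 ≤ L)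
    (hlip : ∀ i, ∀ x ∈ unitI, ∀ y ∈ unitI, |φ i x - φ i y| ≤ ρ * |x - y|)
    (hdist : ∀ i, ∀ s ⊆ unitI, ∀ d : ℝ, (∀ x ∈ s, ∀ y ∈ s, |x - y| ≤ d) →
      DistortionOn (φ i) s (1 + L * d)) (u : List Λ) :
    DistortionOn (compWord φ u) unitI (Real.exp (L / (1 - ρ))) := by
  have key : DistortionOn (compWord φ u) unitI
      (Real.exp (L * ∑ k ∈ Finset.range u.length, ρ ^ k)) := by
    induction u with
    | nil =>
      intro x _ y _ z _ w _
      simp [compWord, mul_comm]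
    | cons j u ih =>
      have hd : ∀ x ∈ compWord φ u '' unitI, ∀ y ∈ compWord φ u '' unitI,
          |x - y| ≤ ρ ^ u.length := by
        rintro _ ⟨x, hx, rfl⟩ _ ⟨y, hy, rfl⟩
        refine (abs_compWord_sub_le h hρ hlip u x hx y hy).trans
          (mul_le_of_le_one_right (by positivity) ?_)
        rw [abs_le]
        constructor <;> linarith [hx.1, hx.2, hy.1, hy.2]
      have hj := hdist j _ (mapsTo_compWord h u).image_subset _ hd
      refine (hj.comp ih (mapsTo_image _ _) (Real.exp_pos _).le (by positivity)).mono ?_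
      rw [List.length_cons, Finset.sum_range_succ, mul_add, Real.exp_add, mul_comm]
      gcongr
      linarith [Real.add_one_le_exp (L * ρ ^ u.length)]
  refine key.mono ?_
  rw [div_eq_mul_inv, ← tsum_geometric_of_lt_one hρ hρ1]
  gcongr
  exact (summable_geometric_of_lt_one hρ hρ1).sum_le_tsum _ fun k _ => by positivity

theorem measure_le_of_inter_unitI_subset {μ : Measure ℝ} (hμI : μ unitIᶜ = 0) {A B : Set ℝ}
    (h : unitI ∩ A ⊆ B) : μ A ≤ μ B :=
  calc μ A ≤ μ (B ∪ unitIᶜ) := measure_mono fun y hy => by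
        by_cases hyI : y ∈ unitI
        · exact Or.inl (h ⟨hyI, hy⟩)
        · exact Or.inr hyI
    _ ≤ μ B + μ unitIᶜ := measure_union_le _ _
    _ = μ B := by rw [hμI, add_zero]

theorem aemeasurable_of_continuousOn_unitI {μ : Measure ℝ} (hμI : μ unitIᶜ = 0) {f : ℝ → ℝ}
    (hf : ContinuousOn f unitI) : AEMeasurable f μ := by
  have h : μ.restrict unitI = μ :=
    Measure.restrict_eq_self_of_ae_mem (mem_ae_iff.2 hμI)
  rw [← h]
  exact hf.aemeasurable measurableSet_Icc

theorem measure_eq_sum_preimage {Λ : Type*} [Fintype Λ] {φ : Λ → ℝ → ℝ} {p : Λ → ℝ}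
    {μ : Measure ℝ} (hφ : ∀ i, AEMeasurable (φ i) μ)
    (hμ : μ = ∑ i : Λ, ENNReal.ofReal (p i) • Measure.map (φ i) μ) {A : Set ℝ}
    (hA : MeasurableSet A) : μ A = ∑ i, ENNReal.ofReal (p i) * μ (φ i ⁻¹' A) := by
  conv_lhs => rw [hμ]
  simp [Measure.finsetSum_apply, Measure.map_apply_of_aemeasurable (hφ _) hA]

theorem sum_ofReal_mul_le {Λ : Type*} [Fintype Λ] {p : Λ → ℝ} (hp : ∀ i, 0 < p i)
    (hp1 : ∑ i, p i = 1) {a : Λ → ENNReal} {c : ENNReal} (ha : ∀ i, a i ≤ c) :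
    ∑ i, ENNReal.ofReal (p i) * a i ≤ c :=
  calc ∑ i, ENNReal.ofReal (p i) * a i ≤ ∑ i, ENNReal.ofReal (p i) * c := by
        gcongr with i; exact ha i
    _ = c := by
      rw [← Finset.sum_mul, ← ENNReal.ofReal_sum_of_nonneg fun i _ => (hp i).le, hp1]
      simp

theorem eq_of_le_sum_ofReal_mul {Λ : Type*} [Fintype Λ] {p : Λ → ℝ} (hp : ∀ i, 0 < p i)
    (hp1 : ∑ i, p i = 1) {a : Λ → ENNReal} {c : ENNReal} (ha : ∀ i, a i ≤ c) (hc : c ≠ ⊤)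
    (h : c ≤ ∑ i, ENNReal.ofReal (p i) * a i) (i : Λ) : a i = c := by
  have ha' : ∀ j, (a j).toReal ≤ c.toReal := fun j => ENNReal.toReal_mono hc (ha j)
  have hat : ∀ j, a j ≠ ⊤ := fun j => ne_top_of_le_ne_top hc (ha j)
  have hpa : ∀ j ∈ Finset.univ, ENNReal.ofReal (p j) * a j ≠ ⊤ :=
    fun j _ => ENNReal.mul_ne_top ENNReal.ofReal_ne_top (hat j)
  have h' := ENNReal.toReal_mono (ENNReal.sum_ne_top.2 hpa) h
  rw [ENNReal.toReal_sum hpa] at h'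
  simp only [ENNReal.toReal_mul, ENNReal.toReal_ofReal (hp _).le] at h'
  rw [← ENNReal.toReal_eq_toReal_iff' (hat i) hc]
  refine le_antisymm (ha' i) (not_lt.1 fun hlt => not_lt.2 h' ?_)
  calc ∑ j, p j * (a j).toReal < ∑ j, p j * c.toReal :=
        Finset.sum_lt_sum (fun j _ => mul_le_mul_of_nonneg_left (ha' j) (hp j).le)
          ⟨i, Finset.mem_univ i, mul_lt_mul_of_pos_left hlt (hp i)⟩
    _ = c.toReal := by rw [← Finset.sum_mul, hp1, one_mul]

/-- The stationary measure of a contracting injective IFS without common fixed point has no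
atoms. -/
theorem measure_singleton_eq_zero_of_stationary {Λ : Type*} [Fintype Λ] [Nonempty Λ]
    {φ : Λ → ℝ → ℝ} (hc : ∀ i, ContinuousOn (φ i) unitI)
    (hinj : ∀ i, InjOn (φ i) unitI) {ρ : ℝ} (hρ1 : ρ < 1)
    (hlip : ∀ i, ∀ x ∈ unitI, ∀ y ∈ unitI, |φ i x - φ i y| ≤ ρ * |x - y|)
    (hnofix : ¬ ∃ x ∈ unitI, ∀ i, φ i x = x)
    {p : Λ → ℝ} (hp : ∀ i, 0 < p i) (hp1 : ∑ i, p i = 1)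
    {μ : Measure ℝ} [IsProbabilityMeasure μ] (hμI : μ unitIᶜ = 0)
    (hμ : μ = ∑ i : Λ, ENNReal.ofReal (p i) • Measure.map (φ i) μ) (x : ℝ) : μ {x} = 0 := by
  by_contra hx
  have hfin : ∀ c : ENNReal, c ≠ 0 → {y : ℝ | c ≤ μ {y}}.Finite := by
    intro c hc0
    exact Measure.finite_const_le_meas_of_disjoint_iUnion μ (pos_iff_ne_zero.2 hc0)
      (fun y => measurableSet_singleton y)
      (fun a b hab => disjoint_singleton.2 hab) (measure_ne_top _ _)
  obtain ⟨x₀, hx₀, hmax'⟩ := exists_max_image _ (fun y : ℝ => μ {y}) (hfin _ hx) ⟨x, le_refl (μ {x})⟩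
  have hmax : ∀ y, μ {y} ≤ μ {x₀} := by
    intro y
    rcases le_total (μ {x}) (μ {y}) with h | h
    · exact hmax' y h
    · exact h.trans hx₀
  have h0 : μ {x₀} ≠ 0 := fun h => hx (le_antisymm ((hmax x).trans h.le) zero_le)
  set S : Set ℝ := {y | μ {x₀} ≤ μ {y}} with hS
  have hSfin : S.Finite := hfin _ h0
  have hSI : S ⊆ unitI := by
    intro y hy
    by_contra hyI
    exact h0 (le_antisymm (hy.trans ((measure_mono (singleton_subset_iff.2 hyI)).trans hμI.le))
      zero_le)
  have hfib : ∀ i y, ∃ z, μ (φ i ⁻¹' {y}) ≤ μ {z} ∧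
      (μ (φ i ⁻¹' {y}) ≠ 0 → z ∈ unitI ∧ φ i z = y) := by
    intro i y
    rcases (unitI ∩ φ i ⁻¹' {y}).eq_empty_or_nonempty with h | ⟨z, hzI, hz⟩
    · refine ⟨0, ?_⟩
      have h' : μ (φ i ⁻¹' {y}) = 0 :=
        le_antisymm ((measure_le_of_inter_unitI_subset hμI h.subset).trans measure_empty.le)
          zero_le
      simp [h']
    · refine ⟨z, ?_, fun _ => ⟨hzI, hz⟩⟩
      refine measure_le_of_inter_unitI_subset hμI fun w hw => hinj i hw.1 hzI ?_
      rw [show φ i w = y from hw.2, show φ i z = y from hz]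
  have hpre : ∀ i, S ⊆ φ i '' S := by
    intro i y hy
    obtain ⟨z, hz, hz'⟩ := hfib i y
    have hle : ∀ j, μ (φ j ⁻¹' {y}) ≤ μ {x₀} := fun j =>
      let ⟨w, hw, _⟩ := hfib j y
      hw.trans (hmax w)
    have heq : μ (φ i ⁻¹' {y}) = μ {x₀} := by
      refine eq_of_le_sum_ofReal_mul hp hp1 hle (measure_ne_top _ _) ?_ i
      rw [← measure_eq_sum_preimage
        (fun j => aemeasurable_of_continuousOn_unitI hμI (hc j)) hμ (measurableSet_singleton y)]
      exact hy
    refine ⟨z, ?_, (hz' (heq ▸ h0)).2⟩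
    exact heq.ge.trans hz
  obtain ⟨a, ha, hamin⟩ := exists_min_image S id hSfin ⟨x₀, le_refl (μ {x₀})⟩
  obtain ⟨b, hb, hbmax⟩ := exists_max_image S id hSfin ⟨x₀, le_refl (μ {x₀})⟩
  have hab : ∀ y ∈ S, y = a := by
    obtain ⟨i⟩ := ‹Nonempty Λ›
    obtain ⟨a', ha', rfl⟩ := hpre i ha
    obtain ⟨b', hb', rfl⟩ := hpre i hb
    simp only [id] at hamin hbmax
    have h1 := hlip i b' (hSI hb') a' (hSI ha')
    have h2 : |b' - a'| ≤ φ i b' - φ i a' :=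
      abs_le.2 ⟨by linarith [hamin _ hb', hbmax _ ha'], by linarith [hbmax _ hb', hamin _ ha']⟩
    have h3 := le_abs_self (φ i b' - φ i a')
    have h4 : |b' - a'| ≤ 0 := by
      by_contra hpos
      nlinarith [abs_nonneg (b' - a')]
    have h5 : φ i b' - φ i a' ≤ 0 := by
      have : |b' - a'| = 0 := le_antisymm h4 (abs_nonneg _)
      rw [this] at h1
      linarith
    intro y hy
    linarith [hamin y hy, hbmax y hy]
  refine hnofix ⟨a, hSI ha, fun i => ?_⟩
  obtain ⟨c, hcS, hca⟩ := hpre i ha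
  rw [hab c hcS] at hca
  exact hca

/-- A finite measure on `unitI` without atoms is uniformly small on small balls. -/
theorem exists_measure_ball_lt {μ : Measure ℝ} [IsFiniteMeasure μ]
    (hna : ∀ x, μ {x} = 0) {η : ENNReal} (hη : 0 < η) :
    ∃ τ : ℝ, 0 < τ ∧ ∀ x ∈ unitI, μ (ball x τ) < η := by
  have hloc : ∀ x : ℝ, ∃ r : ℝ, 0 < r ∧ μ (ball x r) < η := by
    intro x
    have h := tendsto_measure_cthickening_of_isClosed (μ := μ) (s := {x})
      ⟨1, one_pos, measure_ne_top _ _⟩ isClosed_singleton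
    rw [hna] at h
    have h' := (h.mono_left (nhdsWithin_le_nhds (s := Ioi 0))).eventually (gt_mem_nhds hη)
    obtain ⟨r, hr, hr0⟩ := (h'.and self_mem_nhdsWithin).exists
    refine ⟨r, hr0, (measure_mono ?_).trans_lt hr⟩
    rw [cthickening_singleton _ (le_of_lt hr0)]
    exact ball_subset_closedBall
  choose r hr hrη using hloc
  obtain ⟨τ, hτ, h⟩ := lebesgue_number_lemma_of_metric (isCompact_Icc (a := (0 : ℝ)) (b := 1))
    (fun x => isOpen_ball (x := x) (ε := r x))
    (fun x _ => mem_iUnion.2 ⟨x, mem_ball_self (hr x)⟩)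
  exact ⟨τ, hτ, fun x hx => let ⟨y, hy⟩ := h x hx; (measure_mono hy).trans_lt (hrη y)⟩

theorem exists_int_abs_sub_le_of_mem_dyadic_boundary {n : ℕ} {t y : ℝ} (ht : 0 ≤ t)
    (hy : y ∈ ⋃ m : ℤ, cthickening t (frontier (dyadIco n m))) :
    ∃ j : ℤ, |y - j / 2 ^ n| ≤ t := by
  obtain ⟨m, hm⟩ := mem_iUnion.1 hy
  have hlt : (m : ℝ) / 2 ^ n < ((m : ℝ) + 1) / 2 ^ n := by gcongr; linarith
  rw [dyadIco, frontier_Ico hlt,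
    (Set.toFinite _).isCompact.cthickening_eq_biUnion_closedBall ht] at hm
  simp only [mem_insert_iff, mem_singleton_iff, iUnion_iUnion_eq_or_left, iUnion_iUnion_eq_left,
    mem_union, mem_closedBall, Real.dist_eq] at hm
  rcases hm with h | h
  · exact ⟨m, h⟩
  · exact ⟨m + 1, by push_cast; exact h⟩

theorem small_mass_near_dyadic_boundaries
    {Λ : Type} [Fintype Λ] [Nonempty Λ]
    (φ : Λ → ℝ → ℝ)
    (hanal : ∀ i, AnalyticOnNhd ℝ (φ i) unitI)
    (hmaps : ∀ i, Set.MapsTo (φ i) unitI unitI)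
    (hderiv : ∀ i, ∀ x ∈ unitI, 0 < |deriv (φ i) x| ∧ |deriv (φ i) x| < 1)
    (hnofix : ¬ ∃ x ∈ unitI, ∀ i, φ i x = x)
    (p : Λ → ℝ) (hp : ∀ i, 0 < p i) (hp1 : ∑ i, p i = 1)
    (μ : Measure ℝ) (hprob : IsProbabilityMeasure μ) (hμI : μ unitIᶜ = 0)
    (hμ : μ = ∑ i : Λ, ENNReal.ofReal (p i) • Measure.map (φ i) μ)
    :
    ∀ ε : ℝ, 0 < ε → ε < 1 →
      ∃ δ : ℝ, 0 < δ ∧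
        ∀ ψ : ℝ → ℝ, ContDiffOn ℝ 1 ψ unitI →
          (∀ x ∈ unitI, ε ≤ |derivWithin ψ unitI x| ∧ |derivWithin ψ unitI x| ≤ ε⁻¹) →
          ∀ n : ℕ,
            (μ.map ψ) (⋃ m : ℤ, Metric.cthickening ((2 : ℝ) ^ (-(n : ℤ)) * δ)
              (frontier (dyadIco n m))) < ENNReal.ofReal ε := by
  intro ε hε hε1
  choose ρ' m' L' hρ0' hρ1' hm0' hL0' hbi' hdist' using
    fun i => exists_contraction_distortion_bounds (hanal i) (hderiv i)
  obtain ⟨iρ, hiρ⟩ := Finite.exists_max ρ'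
  obtain ⟨im, him⟩ := Finite.exists_min m'
  obtain ⟨iL, hiL⟩ := Finite.exists_max L'
  set ρ := ρ' iρ
  set m := m' im
  set L := L' iL
  have hρ0 : 0 < ρ := hρ0' iρ
  have hρ1 : ρ < 1 := hρ1' iρ
  have hm0 : 0 < m := hm0' im
  have hL0 : 0 ≤ L := hL0' iL
  have hlip : ∀ i, ∀ x ∈ unitI, ∀ y ∈ unitI, |φ i x - φ i y| ≤ ρ * |x - y| :=
    fun i x hx y hy => (hbi' i x hx y hy).2.trans (by gcongr; exact hiρ i)
  have hlow : ∀ i, ∀ x ∈ unitI, ∀ y ∈ unitI, m * |x - y| ≤ |φ i x - φ i y| :=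
    fun i x hx y hy => le_trans (by gcongr; exact him i) (hbi' i x hx y hy).1
  have hdist : ∀ i, ∀ s ⊆ unitI, ∀ d : ℝ, (∀ x ∈ s, ∀ y ∈ s, |x - y| ≤ d) →
      DistortionOn (φ i) s (1 + L * d) := by
    intro i s hs d hd
    rcases s.eq_empty_or_nonempty with rfl | ⟨x, hx⟩
    · intro x hx
      exact hx.elim
    · have : 0 ≤ d := (abs_nonneg _).trans (hd x hx x hx)
      exact (hdist' i s hs d hd).mono (by gcongr; exact hiL i)
  have hcont : ∀ i, ContinuousOn (φ i) unitI := fun i => (hanal i).continuousOn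
  have hinj : ∀ i, InjOn (φ i) unitI := by
    intro i x hx y hy hxy
    have h := hlow i x hx y hy
    rw [hxy, sub_self, abs_zero] at h
    have h' : |x - y| ≤ 0 := by
      by_contra hpos
      nlinarith
    exact sub_eq_zero.1 (abs_eq_zero.1 (le_antisymm h' (abs_nonneg _)))
  have hna := measure_singleton_eq_zero_of_stationary hcont hinj hρ1 hlip hnofix hp hp1 hμI hμ
  obtain ⟨τ, hτ, hball⟩ := exists_measure_ball_lt hna
    (ENNReal.ofReal_pos.2 (half_pos hε))
  have h0I : (0 : ℝ) ∈ unitI := by simp [unitI]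
  have h1I : (1 : ℝ) ∈ unitI := by simp [unitI]
  set K₀ : ℝ := Real.exp (L / (1 - ρ))
  have hK₀ : 1 ≤ K₀ := Real.one_le_exp (div_nonneg hL0 (by linarith))
  set K : ℝ := ε⁻¹ / ε * K₀ with hK
  have hεinv : 1 ≤ ε⁻¹ / ε := by
    rw [le_div_iff₀ hε, one_mul]
    exact hε1.le.trans (one_le_inv₀ hε |>.2 hε1.le)
  have hK1 : 1 ≤ K := one_le_mul_of_one_le_of_one_le hεinv hK₀
  have hK0 : 0 < K := by linarith
  set κ : ℝ := min ε (m / K)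
  have hκ : 0 < κ := lt_min hε (by positivity)
  set δ : ℝ := min (1 / 8) (κ * τ / (16 * K ^ 2)) with hδ
  have hδ0 : 0 < δ := lt_min (by norm_num) (by positivity)
  have hδ8 : δ ≤ 1 / 8 := min_le_left _ _
  have hδτ : 8 * K ^ 2 * δ / κ < τ := by
    have h : δ ≤ κ * τ / (16 * K ^ 2) := min_le_right _ _
    rw [le_div_iff₀ (by positivity)] at h
    rw [div_lt_iff₀ hκ]
    nlinarith [mul_pos hκ hτ]
  refine ⟨δ, hδ0, fun ψ hψ hψd n => ?_⟩
  set q : ℝ := (2 : ℝ) ^ (-(n : ℤ)) with hq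
  have hq0 : 0 < q := by positivity
  have hqn : q = 1 / 2 ^ n := by rw [hq, zpow_neg, zpow_natCast, one_div]
  have hq1 : q ≤ 1 := by
    rw [hqn, div_le_one (by positivity)]
    exact one_le_pow₀ (by norm_num)
  set B : Set ℝ := ⋃ m : ℤ, cthickening (q * δ) (frontier (dyadIco n m)) with hB
  have hBm : MeasurableSet B :=
    MeasurableSet.iUnion fun m => isClosed_cthickening.measurableSet
  have hψbi := bilipschitz_of_deriv_bounds hψ.continuousOn
    (fun x hx => ((hψ.differentiableOn one_ne_zero).differentiableAt
      (mem_interior_iff_mem_nhds.1 hx)))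
    (a := ε) (b := ε⁻¹) (fun x hx => by
      rw [← derivWithin_of_mem_nhds (mem_interior_iff_mem_nhds.1 hx)]
      exact hψd x (interior_subset hx))
  have hψdist : DistortionOn ψ unitI (ε⁻¹ / ε) := distortionOn_of_bilipschitz hε (by positivity)
    (fun x hx y hy => (hψbi x hx y hy).1) (fun x hx y hy => (hψbi x hx y hy).2)
  have hword : ∀ u, DistortionOn (ψ ∘ compWord φ u) unitI K := fun u =>
    hψdist.comp (distortionOn_compWord hmaps hρ0.le hρ1 hL0 hlip hdist u)
      (mapsTo_compWord hmaps u) (by positivity) (by positivity)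
  have hwc : ∀ u, ContinuousOn (ψ ∘ compWord φ u) unitI := fun u =>
    hψ.continuousOn.comp (continuousOn_compWord hmaps hcont u) (mapsTo_compWord hmaps u)
  set r : ℝ := q / (4 * K) with hr
  have hr0 : 0 < r := by positivity
  have hr1 : r ≤ 1 := by
    rw [hr, div_le_one (by positivity)]
    linarith
  -- Words at scale comparable to `2 ^ (-n)`.
  have hsmall : ∀ f : ℝ → ℝ, DistortionOn f unitI K → κ * r ≤ |f 0 - f 1| → |f 0 - f 1| ≤ r →
      μ (unitI ∩ f ⁻¹' B) ≤ ENNReal.ofReal (ε / 2) := by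
    intro f hf hlo hhi
    have hclose : ∀ x ∈ unitI ∩ f ⁻¹' B, ∀ y ∈ unitI ∩ f ⁻¹' B, |x - y| < τ := by
      rintro x ⟨hx, hxB⟩ y ⟨hy, hyB⟩
      obtain ⟨j, hj⟩ := exists_int_abs_sub_le_of_mem_dyadic_boundary (by positivity) hxB
      obtain ⟨k, hk⟩ := exists_int_abs_sub_le_of_mem_dyadic_boundary (by positivity) hyB
      have hxy1 : |x - y| ≤ 1 :=
        abs_le.2 ⟨by linarith [hx.1, hy.2], by linarith [hx.2, hy.1]⟩
      have h1 : |f x - f y| ≤ q / 4 := by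
        have h := hf x hx y hy 0 h0I 1 h1I
        rw [show |(0 : ℝ) - 1| = 1 by norm_num, mul_one] at h
        calc |f x - f y| ≤ K * (|f 0 - f 1| * |x - y|) := h
          _ ≤ K * (r * 1) := by gcongr
          _ = q / 4 := by rw [hr]; field_simp
      have hjk : j = k := by
        have e1 : ((j : ℝ) - k) * q = j / 2 ^ n - k / 2 ^ n := by rw [hqn]; ring
        have hqd : q * δ ≤ q / 8 := by nlinarith
        rw [abs_le] at hj hk h1
        have e2 : ((j : ℝ) - k) * q < 1 * q := by rw [e1]; linarith
        have e3 : (-1) * q < ((j : ℝ) - k) * q := by rw [e1]; linarith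
        have e4 : (j : ℝ) - k < 1 := lt_of_mul_lt_mul_right e2 hq0.le
        have e5 : (-1 : ℝ) < (j : ℝ) - k := lt_of_mul_lt_mul_right e3 hq0.le
        have e6 : j - k < 1 := by exact_mod_cast e4
        have e7 : -1 < j - k := by exact_mod_cast e5
        omega
      have h2 : |f x - f y| ≤ 2 * (q * δ) := by
        subst hjk
        rw [abs_le] at hj hk ⊢
        constructor <;> linarith
      refine lt_of_le_of_lt ?_ hδτ
      have h := hf 0 h0I 1 h1I x hx y hy
      rw [show |(0 : ℝ) - 1| = 1 by norm_num, mul_one] at h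
      rw [le_div_iff₀ hκ]
      refine le_of_mul_le_mul_right ?_ hr0
      calc |x - y| * κ * r = κ * r * |x - y| := by ring
        _ ≤ |f 0 - f 1| * |x - y| := by gcongr
        _ ≤ K * |f x - f y| := h
        _ ≤ K * (2 * (q * δ)) := by gcongr
        _ = 8 * K ^ 2 * δ * r := by rw [hr]; field_simp; ring
    rcases (unitI ∩ f ⁻¹' B).eq_empty_or_nonempty with h | ⟨x, hx⟩
    · simp [h]
    · refine (measure_mono fun y hy => ?_).trans (hball x hx.1).le
      rw [mem_ball, Real.dist_eq]
      exact hclose y hy x hx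
  obtain ⟨N, hN⟩ := exists_pow_lt_of_lt_one (show 0 < ε * r by positivity) hρ1
  have hrec : ∀ k : ℕ, ∀ u : List Λ, N ≤ u.length + k →
      κ * r ≤ |(ψ ∘ compWord φ u) 0 - (ψ ∘ compWord φ u) 1| →
      μ (unitI ∩ (ψ ∘ compWord φ u) ⁻¹' B) ≤ ENNReal.ofReal (ε / 2) := by
    intro k
    induction k with
    | zero =>
      intro u hu hlo
      refine hsmall _ (hword u) hlo ?_
      calc |ψ (compWord φ u 0) - ψ (compWord φ u 1)|
          ≤ ε⁻¹ * |compWord φ u 0 - compWord φ u 1| :=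
            (hψbi _ (mapsTo_compWord hmaps u h0I) _ (mapsTo_compWord hmaps u h1I)).2
        _ ≤ ε⁻¹ * (ρ ^ u.length * |0 - 1|) := by
            gcongr
            exact abs_compWord_sub_le hmaps hρ0.le hlip u 0 h0I 1 h1I
        _ ≤ ε⁻¹ * (ρ ^ N * 1) := by
            gcongr ε⁻¹ * (?_ * ?_)
            · exact pow_le_pow_of_le_one hρ0.le hρ1.le hu
            · norm_num
        _ ≤ ε⁻¹ * (ε * r * 1) := by gcongr
        _ = r := by field_simp
    | succ k ih =>
      intro u hu hlo
      rcases le_or_gt |(ψ ∘ compWord φ u) 0 - (ψ ∘ compWord φ u) 1| r with hle | hgt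
      · exact hsmall _ (hword u) hlo hle
      have hAm : MeasurableSet (unitI ∩ (ψ ∘ compWord φ u) ⁻¹' B) := by
        rw [hB, preimage_iUnion, inter_iUnion]
        exact MeasurableSet.iUnion fun m =>
          ((hwc u).preimage_isClosed_of_isClosed isClosed_Icc isClosed_cthickening).measurableSet
      rw [measure_eq_sum_preimage
        (fun j => aemeasurable_of_continuousOn_unitI hμI (hcont j)) hμ hAm]
      refine sum_ofReal_mul_le hp hp1 fun i => ?_
      have hnext := ih (u ++ [i]) (by simp; omega) (by
        rw [compWord_append_singleton]
        have h := hword u 0 h0I 1 h1I _ (hmaps i h0I) _ (hmaps i h1I)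
        have hmi := hlow i 0 h0I 1 h1I
        rw [show |(0 : ℝ) - 1| = 1 by norm_num, mul_one] at hmi h
        have hκm : κ ≤ m / K := min_le_right _ _
        rw [le_div_iff₀ hK0] at hκm
        refine le_of_mul_le_mul_left ?_ hK0
        calc K * (κ * r) = r * (κ * K) := by ring
          _ ≤ |(ψ ∘ compWord φ u) 0 - (ψ ∘ compWord φ u) 1| * |φ i 0 - φ i 1| := by
              gcongr
              exact hκm.trans hmi
          _ ≤ _ := h)
      refine le_trans ?_ hnext
      rw [compWord_append_singleton]
      exact measure_le_of_inter_unitI_subset hμI fun y hy => ⟨hy.1, hy.2.2⟩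
  have hfinal := hrec N [] (by simp) (by
    have h := (hψbi 0 h0I 1 h1I).1
    rw [show |(0 : ℝ) - 1| = 1 by norm_num, mul_one] at h
    calc κ * r ≤ ε * 1 := by
          gcongr
          exact min_le_left _ _
      _ = ε := mul_one ε
      _ ≤ _ := h)
  rw [Measure.map_apply_of_aemeasurable
    (aemeasurable_of_continuousOn_unitI hμI hψ.continuousOn) hBm]
  calc μ (ψ ⁻¹' B) ≤ μ (unitI ∩ ψ ⁻¹' B) := measure_le_of_inter_unitI_subset hμI subset_rfl
    _ ≤ ENNReal.ofReal (ε / 2) := hfinal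
    _ < ENNReal.ofReal ε := (ENNReal.ofReal_lt_ofReal_iff hε).2 (half_lt_self hε)
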